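/- Let 1 ≤ k < n be integers and let c be an integer with max{0, 2k−n} ≤ c ≤ k−1. Then there exists Q such that for every prime power q ≥ Q the following holds: if C ⊆ G_q(k,n) is an equidistant c-intersecting code with |C| = e_q(k,n,c), and if at least one of the conditions (i) c ∈ {0, k−1, 2k−n}, (ii) 2n ≤ 3k+1, (iii) n ≥ 3k+1 holds, then either C is a sunflower or C^⊥ is a sunflower; moreover, unless c = 0 and n = 2k, exactly one of the two alternatives holds. -/

import Mathlib

open Submodule Module Set

/-- The orthogonal complement of a subspace of `Fin n → F` with respect to the
standard bilinear form `(x, y) ↦ ∑ i, x i * y i`. -/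
def stdOrth {F : Type} [Field F] {n : ℕ} (U : Submodule F (Fin n → F)) :
    Submodule F (Fin n → F) where
  carrier := {x | ∀ y ∈ U, ∑ i, x i * y i = 0}
  add_mem' := by
    intro a b ha hb y hy
    simp only [Set.mem_setOf_eq] at *
    simp [add_mul, Finset.sum_add_distrib, ha y hy, hb y hy]
  zero_mem' := by intro y hy; simp
  smul_mem' := by
    intro c a ha y hy
    simp only [Set.mem_setOf_eq] at *
    simp [smul_eq_mul, mul_assoc, ← Finset.mul_sum, ha y hy]

/-- An equidistant `c`-intersecting subspace code of constant dimension `k` in `F^n`: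
a set of at least two `k`-dimensional subspaces, any two distinct members of which
intersect in dimension `c`. -/
def IsEquidistantCode (F : Type) [Field F] (n k c : ℕ)
    (C : Set (Submodule F (Fin n → F))) : Prop :=
  2 ≤ C.ncard ∧ (∀ U ∈ C, Module.finrank F U = k) ∧
    ∀ U ∈ C, ∀ V ∈ C, U ≠ V → Module.finrank F ↥(U ⊓ V) = c

/-- A set of subspaces is a sunflower if there is a common center `Z` equal to the
intersection of any two distinct members. -/
def IsSunflower {F : Type} [Field F] {n : ℕ} (C : Set (Submodule F (Fin n → F))) : Prop :=
  ∃ Z : Submodule F (Fin n → F), ∀ U ∈ C, ∀ V ∈ C, U ≠ V → U ⊓ V = Z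

/-- `eMax F n k c` is the maximum cardinality of an equidistant `c`-intersecting
code of constant dimension `k` in `F^n`. -/
noncomputable def eMax (F : Type) [Field F] (n k c : ℕ) : ℕ :=
  sSup {m | ∃ C : Set (Submodule F (Fin n → F)), IsEquidistantCode F n k c C ∧ C.ncard = m}

theorem mem_stdOrth {F : Type} [Field F] {n : ℕ} (U : Submodule F (Fin n → F)) (x : Fin n → F) :
    x ∈ stdOrth U ↔ ∀ y ∈ U, ∑ i, x i * y i = 0 := Iff.rfl

theorem stdOrth_eq {F : Type} [Field F] {n : ℕ} (U : Submodule F (Fin n → F)) :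
    stdOrth U = LinearMap.BilinForm.orthogonal (Matrix.toBilin' (1 : Matrix (Fin n) (Fin n) F)) U := by
  ext x
  rw [mem_stdOrth, LinearMap.BilinForm.mem_orthogonal_iff]
  refine forall₂_congr fun y _ => ?_
  rw [Matrix.toBilin'_apply']
  simp [dotProduct, mul_comm]

theorem std_nondeg (F : Type) [Field F] (n : ℕ) :
    (Matrix.toBilin' (1 : Matrix (Fin n) (Fin n) F)).Nondegenerate :=
  LinearMap.BilinForm.nondegenerate_toBilin'_of_det_ne_zero' _ (by simp)

theorem std_refl (F : Type) [Field F] (n : ℕ) :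
    LinearMap.IsRefl (Matrix.toBilin' (1 : Matrix (Fin n) (Fin n) F)) := by
  intro x y h
  rw [Matrix.toBilin'_apply'] at h ⊢
  simpa [dotProduct_comm] using h

theorem finrank_stdOrth {F : Type} [Field F] {n : ℕ} (U : Submodule F (Fin n → F)) :
    finrank F (stdOrth U) = n - finrank F U := by
  rw [stdOrth_eq, LinearMap.BilinForm.finrank_orthogonal (std_nondeg F n)]
  simp

theorem stdOrth_stdOrth {F : Type} [Field F] {n : ℕ} (U : Submodule F (Fin n → F)) :
    stdOrth (stdOrth U) = U := by
  rw [stdOrth_eq, stdOrth_eq, LinearMap.BilinForm.orthogonal_orthogonal (std_nondeg F n) (std_refl F n)]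

theorem stdOrth_inj {F : Type} [Field F] {n : ℕ} :
    Function.Injective (stdOrth : Submodule F (Fin n → F) → _) :=
  Function.LeftInverse.injective stdOrth_stdOrth

theorem stdOrth_anti {F : Type} [Field F] {n : ℕ} {U V : Submodule F (Fin n → F)} (h : U ≤ V) :
    stdOrth V ≤ stdOrth U := fun _ hx y hy => hx y (h hy)

theorem stdOrth_sup {F : Type} [Field F] {n : ℕ} (U V : Submodule F (Fin n → F)) :
    stdOrth (U ⊔ V) = stdOrth U ⊓ stdOrth V := by
  apply le_antisymm
  · exact le_inf (stdOrth_anti le_sup_left) (stdOrth_anti le_sup_right)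
  · rw [← stdOrth_stdOrth (stdOrth U ⊓ stdOrth V)]
    apply stdOrth_anti
    apply sup_le
    · conv_lhs => rw [← stdOrth_stdOrth U]
      exact stdOrth_anti inf_le_left
    · conv_lhs => rw [← stdOrth_stdOrth V]
      exact stdOrth_anti inf_le_right

theorem image_stdOrth_image {F : Type} [Field F] {n : ℕ} (C : Set (Submodule F (Fin n → F))) :
    stdOrth '' (stdOrth '' C) = C := by
  rw [Set.image_image]; simp [stdOrth_stdOrth]

theorem ncard_stdOrth {F : Type} [Field F] {n : ℕ} (C : Set (Submodule F (Fin n → F))) :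
    (stdOrth '' C).ncard = C.ncard := Set.ncard_image_of_injective _ stdOrth_inj

theorem finrank_sup_code {F : Type} [Field F] {n k c : ℕ}
    {U V : Submodule F (Fin n → F)} (hU : finrank F U = k) (hV : finrank F V = k)
    (h : finrank F ↥(U ⊓ V) = c) : finrank F ↥(U ⊔ V) = 2 * k - c := by
  have := Submodule.finrank_sup_add_finrank_inf_eq U V
  omega

theorem code_dual {F : Type} [Field F] {n k c : ℕ} {C : Set (Submodule F (Fin n → F))}
    (hkn : k < n) (hck : c < k) (hC : IsEquidistantCode F n k c C) :
    IsEquidistantCode F n (n - k) (n + c - 2 * k) (stdOrth '' C) := by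
  obtain ⟨h1, h2, h3⟩ := hC
  refine ⟨by rwa [ncard_stdOrth], ?_, ?_⟩
  · rintro _ ⟨U, hU, rfl⟩
    rw [finrank_stdOrth, h2 U hU]
  · rintro _ ⟨U, hU, rfl⟩ _ ⟨V, hV, rfl⟩ hne
    rw [← stdOrth_sup, finrank_stdOrth,
      finrank_sup_code (h2 U hU) (h2 V hV) (h3 U hU V hV (fun h => hne (by rw [h])))]
    omega

/-- the dual is a sunflower iff all sums agree -/
theorem dual_sunflower_iff {F : Type} [Field F] {n : ℕ} {C : Set (Submodule F (Fin n → F))} :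
    IsSunflower (stdOrth '' C) ↔
      ∃ T : Submodule F (Fin n → F), ∀ U ∈ C, ∀ V ∈ C, U ≠ V → U ⊔ V = T := by
  constructor
  · rintro ⟨Z, hZ⟩
    refine ⟨stdOrth Z, fun U hU V hV hne => ?_⟩
    rw [← hZ _ ⟨U, hU, rfl⟩ _ ⟨V, hV, rfl⟩ (fun h => hne (stdOrth_inj h)), ← stdOrth_sup,
      stdOrth_stdOrth]
  · rintro ⟨T, hT⟩
    refine ⟨stdOrth T, ?_⟩
    rintro _ ⟨U, hU, rfl⟩ _ ⟨V, hV, rfl⟩ hne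
    rw [← stdOrth_sup, hT U hU V hV (fun h => hne (by rw [h]))]

theorem finite_sub (F : Type) [Field F] [Finite F] (n : ℕ) : Finite (Submodule F (Fin n → F)) :=
  Finite.of_injective (fun U : Submodule F (Fin n → F) => (U : Set (Fin n → F)))
    SetLike.coe_injective

theorem le_eMax {F : Type} [Field F] [Finite F] {n k c : ℕ} {C : Set (Submodule F (Fin n → F))}
    (hC : IsEquidistantCode F n k c C) : C.ncard ≤ eMax F n k c := by
  have := finite_sub F n
  apply le_csSup
  · refine ⟨Nat.card (Submodule F (Fin n → F)), ?_⟩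
    rintro m ⟨C, -, rfl⟩
    rw [← Set.ncard_univ]
    exact Set.ncard_le_ncard (Set.subset_univ _) (Set.toFinite _)
  · exact ⟨C, hC, rfl⟩

/-- codes with `c = k - 1` -/
theorem code_pred {F : Type} [Field F] {n k c : ℕ} {C : Set (Submodule F (Fin n → F))}
    (hk : k = c + 1) (hC : IsEquidistantCode F n k c C) :
    IsSunflower C ∨ IsSunflower (stdOrth '' C) := by
  obtain ⟨-, h2, h3⟩ := hC
  by_contra! hcon
  obtain ⟨hs, hd⟩ := hcon
  have key : ∀ U ∈ C, ∀ V ∈ C, ∀ W ∈ C, U ≠ V → U ≠ W → V ≠ W → ¬ (U ⊓ V ≤ W) → W ≤ U ⊔ V := by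
    intro U hU V hV W hW hUV hUW hVW hnot
    have e1 := h3 U hU W hW hUW
    have e2 := h3 V hV W hW hVW
    have e3 := h3 U hU V hV hUV
    have hne : U ⊓ W ≠ V ⊓ W := by
      intro he
      apply hnot
      have : U ⊓ W = U ⊓ V := Submodule.eq_of_le_of_finrank_eq
        (le_inf inf_le_left (he ▸ inf_le_left)) (by omega)
      rw [← this]; exact inf_le_right
    have hlt : U ⊓ W < (U ⊓ W) ⊔ (V ⊓ W) := by
      refine lt_of_le_of_ne le_sup_left fun he => hne ?_
      exact (Submodule.eq_of_le_of_finrank_eq (sup_eq_left.mp he.symm) (by omega)).symm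
    have := Submodule.finrank_lt_finrank_of_lt hlt
    have heq : (U ⊓ W) ⊔ (V ⊓ W) = W :=
      Submodule.eq_of_le_of_finrank_le (sup_le inf_le_right inf_le_right) (by rw [h2 W hW]; omega)
    rw [← heq]
    exact sup_le_sup inf_le_left inf_le_left
  -- choose a bad triple
  have hbad : ∃ U ∈ C, ∃ V ∈ C, ∃ W ∈ C, U ≠ V ∧ ¬ (U ⊓ V ≤ W) := by
    by_contra! hb
    apply hs
    by_cases hex : ∃ U ∈ C, ∃ V ∈ C, U ≠ V
    · obtain ⟨U, hU, V, hV, hne⟩ := hex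
      refine ⟨U ⊓ V, fun X hX Y hY hXY => ?_⟩
      exact (Submodule.eq_of_le_of_finrank_eq
        (le_inf (hb U hU V hV X hX hne) (hb U hU V hV Y hY hne))
        (by rw [h3 U hU V hV hne, h3 X hX Y hY hXY])).symm
    · push Not at hex
      exact ⟨⊥, fun X hX Y hY hXY => absurd (hex X hX Y hY) hXY⟩
  obtain ⟨U, hU, V, hV, W, hW, hUV, hn⟩ := hbad
  have hUW : U ≠ W := by rintro rfl; exact hn inf_le_left
  have hVW : V ≠ W := by rintro rfl; exact hn inf_le_right
  have hWT := key U hU V hV W hW hUV hUW hVW hn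
  have hall : ∀ X ∈ C, X ≤ U ⊔ V := by
    intro X hX
    by_cases hXU : U = X
    · subst hXU; exact le_sup_left
    by_cases hXV : V = X
    · subst hXV; exact le_sup_right
    by_cases hXW : W = X
    · subst hXW; exact hWT
    by_cases hZ : U ⊓ V ≤ X
    · have hnX : ¬ (U ⊓ W ≤ X) := by
        intro h
        have e1 := h3 U hU W hW hUW
        have e3 := h3 U hU V hV hUV
        have hlt : U ⊓ W < (U ⊓ W) ⊔ (U ⊓ V) := by
          refine lt_of_le_of_ne le_sup_left fun he => hn ?_
          have := sup_eq_left.mp he.symm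
          exact this.trans inf_le_right
        have := Submodule.finrank_lt_finrank_of_lt hlt
        have heq : (U ⊓ W) ⊔ (U ⊓ V) = U :=
          Submodule.eq_of_le_of_finrank_le (sup_le inf_le_left inf_le_left)
            (by rw [h2 U hU]; omega)
        apply hXU
        apply Submodule.eq_of_le_of_finrank_eq
        · rw [← heq]; exact sup_le h hZ
        · rw [h2 U hU, h2 X hX]
      exact (key U hU W hW X hX hUW hXU hXW hnX).trans (sup_le le_sup_left hWT)
    · exact key U hU V hV X hX hUV hXU hXV hZ
  apply hd
  rw [dual_sunflower_iff]
  refine ⟨U ⊔ V, fun X hX Y hY hXY => ?_⟩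
  apply Submodule.eq_of_le_of_finrank_eq (sup_le (hall X hX) (hall Y hY))
  rw [finrank_sup_code (h2 X hX) (h2 Y hY) (h3 X hX Y hY hXY),
    finrank_sup_code (h2 U hU) (h2 V hV) (h3 U hU V hV hUV)]

theorem exists_ext (F : Type) [Field F] [Finite F] (m : ℕ) (hm : 1 ≤ m) :
    ∃ (K : Type) (_ : Field K) (_ : Algebra F K) (_ : Finite K), finrank F K = m := by
  obtain ⟨p, hp⟩ := CharP.exists F
  have : Fact p.Prime := ⟨CharP.char_is_prime F p⟩
  have : NeZero m := ⟨by omega⟩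
  exact ⟨FiniteField.Extension F p m, inferInstance, inferInstance, inferInstance,
    FiniteField.finrank_extension F p m⟩

theorem exists_large {F : Type} [Field F] [Finite F] {n k c : ℕ}
    (hkn : k < n) (hck : c < k) (hc1 : 2 * k ≤ n + c) :
    ∃ C : Set (Submodule F (Fin n → F)), IsEquidistantCode F n k c C ∧
      C.ncard = Nat.card F ^ (n - k) := by
  obtain ⟨K, _, _, _, hK⟩ := exists_ext F (n - k) (by omega)
  obtain ⟨ι, hι⟩ : ∃ ι : (Fin (k - c) → F) →ₗ[F] K, Function.Injective ι := by
    obtain ⟨f, hf⟩ := exists_linearIndependent_of_le_finrank (R := F) (M := K) (n := k - c)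
      (by omega)
    exact ⟨Fintype.linearCombination F f, by
      rwa [linearIndependent_iff_injective_fintypeLinearCombination] at hf⟩
  have hW : finrank F ((Fin c → F) × (Fin (k - c) → F) × K) = finrank F (Fin n → F) := by
    simp [hK]; omega
  let e : ((Fin c → F) × (Fin (k - c) → F) × K) ≃ₗ[F] (Fin n → F) := LinearEquiv.ofFinrankEq _ _ hW
  let φ : K → ((Fin c → F) × (Fin (k - c) → F)) →ₗ[F] ((Fin c → F) × (Fin (k - c) → F) × K) := fun α =>
    LinearMap.prod (LinearMap.fst F _ _)
      (LinearMap.prod (LinearMap.snd F _ _)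
        ((LinearMap.mulLeft F α).comp (ι.comp (LinearMap.snd F _ _))))
  have hφ : ∀ α z, φ α z = (z.1, z.2, α * ι z.2) := fun α z => rfl
  have hinj : ∀ α, Function.Injective (φ α) := by
    rintro α ⟨a, b⟩ ⟨a', b'⟩ h
    simp only [hφ, Prod.mk.injEq] at h
    exact Prod.ext h.1 h.2.1
  let U : K → Submodule F (Fin n → F) := fun α => (LinearMap.range (φ α)).map (e : ((Fin c → F) × (Fin (k - c) → F) × K) →ₗ[F] _)
  have hUr : ∀ α, finrank F (U α) = k := by
    intro α
    rw [LinearEquiv.finrank_map_eq, LinearMap.finrank_range_of_inj (hinj α)]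
    simp; omega
  have hint : ∀ α β, α ≠ β → finrank F ↥(U α ⊓ U β) = c := by
    intro α β hne
    have h1 : U α ⊓ U β = (LinearMap.range (φ α) ⊓ LinearMap.range (φ β)).map (e : ((Fin c → F) × (Fin (k - c) → F) × K) →ₗ[F] _) := by
      rw [Submodule.map_inf _ e.injective]
    have h2 : LinearMap.range (φ α) ⊓ LinearMap.range (φ β) =
        LinearMap.range (LinearMap.inl F (Fin c → F) ((Fin (k - c) → F) × K)) := by
      ext x
      constructor
      · rintro ⟨⟨y, rfl⟩, ⟨z, hz⟩⟩
        simp only [hφ, Prod.mk.injEq] at hz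
        obtain ⟨z1, z2, z3⟩ := hz
        rw [z2] at z3
        have : (β - α) * ι y.2 = 0 := by rw [sub_mul, z3, sub_self]
        have h0 : ι y.2 = 0 := by
          rcases mul_eq_zero.mp this with h | h
          · exact absurd (sub_eq_zero.mp h).symm hne
          · exact h
        have hy : y.2 = 0 := hι (by rw [h0, map_zero])
        refine ⟨y.1, ?_⟩
        rw [hφ, hy]; simp; rfl
      · rintro ⟨y, rfl⟩
        exact ⟨⟨(y, 0), by rw [hφ]; simp⟩, ⟨(y, 0), by rw [hφ]; simp⟩⟩
    rw [h1, h2, LinearEquiv.finrank_map_eq, LinearMap.finrank_range_of_inj LinearMap.inl_injective]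
    simp
  have hUinj : Function.Injective U := by
    intro α β h
    by_contra hne
    have := hint α β hne
    rw [h, inf_idem, hUr] at this
    omega
  have hcard : (Set.range U).ncard = Nat.card F ^ (n - k) := by
    rw [← Set.image_univ, Set.ncard_image_of_injective _ hUinj, Set.ncard_univ,
      Module.natCard_eq_pow_finrank (K := F), hK]
  refine ⟨Set.range U, ⟨?_, ?_, ?_⟩, hcard⟩
  · rw [hcard]
    have : 2 ≤ Nat.card F := Finite.one_lt_card
    calc 2 ≤ Nat.card F := this
      _ ≤ Nat.card F ^ (n - k) := Nat.le_self_pow (by omega) _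
  · rintro _ ⟨α, rfl⟩; exact hUr α
  · rintro _ ⟨α, rfl⟩ _ ⟨β, rfl⟩ hne
    exact hint α β (fun h => hne (by rw [h]))

theorem eMax_ge {F : Type} [Field F] [Finite F] {n k c : ℕ}
    (hkn : k < n) (hck : c < k) (hc1 : 2 * k ≤ n + c) :
    Nat.card F ^ (n - k) ≤ eMax F n k c := by
  obtain ⟨C, hC, h⟩ := exists_large (F := F) hkn hck hc1
  rw [← h]; exact le_eMax hC

theorem eMax_ge' {F : Type} [Field F] [Finite F] {n k c : ℕ}
    (hkn : k < n) (hck : c < k) (hc1 : 2 * k ≤ n + c) :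
    Nat.card F ^ k ≤ eMax F n k c := by
  obtain ⟨C, hC, h⟩ := exists_large (F := F) (n := n) (k := n - k) (c := n + c - 2 * k)
    (by omega) (by omega) (by omega)
  have h1 := code_dual (by omega) (by omega) hC
  rw [show n - (n - k) = k by omega, show n + (n + c - 2 * k) - 2 * (n - k) = c by omega] at h1
  rw [show n - (n - k) = k by omega, ← ncard_stdOrth] at h
  rw [← h]; exact le_eMax h1

theorem card_sub {F : Type} [Field F] [Finite F] {n : ℕ} (U : Submodule F (Fin n → F)) :
    Nat.card U = Nat.card F ^ finrank F U := Module.natCard_eq_pow_finrank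

theorem both_bound {F : Type} [Field F] [Finite F] {n k c : ℕ} {C : Set (Submodule F (Fin n → F))}
    (hck : c < k) (hC : IsEquidistantCode F n k c C) (h1 : IsSunflower C)
    (h2 : IsSunflower (stdOrth '' C)) :
    C.ncard * (Nat.card F ^ k - Nat.card F ^ c) ≤ Nat.card F ^ (2 * k - c) := by
  classical
  have := finite_sub F n
  obtain ⟨hc, hr, hi⟩ := hC
  obtain ⟨Z, hZ⟩ := h1
  obtain ⟨T, hT⟩ := dual_sunflower_iff.mp h2
  have hfin : C.Finite := Set.toFinite _
  obtain ⟨A, hA, B, hB, hAB⟩ := (Set.one_lt_ncard hfin).mp hc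
  have hex : ∀ U ∈ C, ∃ V ∈ C, U ≠ V := by
    intro U hU
    by_cases h : U = A
    · exact ⟨B, hB, h ▸ hAB⟩
    · exact ⟨A, hA, h⟩
  have hZr : finrank F Z = c := by rw [← hZ A hA B hB hAB]; exact hi A hA B hB hAB
  have hTr : finrank F T = 2 * k - c := by
    rw [← hT A hA B hB hAB]; exact finrank_sup_code (hr A hA) (hr B hB) (hi A hA B hB hAB)
  have : Fintype (Fin n → F) := Fintype.ofFinite _
  have hsz : ∀ W : Submodule F (Fin n → F), (Finset.univ.filter (· ∈ W)).card =
      Nat.card F ^ finrank F W := by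
    intro W
    rw [← card_sub, Nat.card_eq_fintype_card, Fintype.card_subtype]
  let s : Finset (Submodule F (Fin n → F)) := hfin.toFinset
  have hs : ∀ U, U ∈ s ↔ U ∈ C := by simp [s]
  let f : Submodule F (Fin n → F) → Finset (Fin n → F) := fun U =>
    Finset.univ.filter (· ∈ U) \ Finset.univ.filter (· ∈ Z)
  have hdisj : (s : Set _).PairwiseDisjoint f := by
    intro U hU V hV hne
    rw [Function.onFun, Finset.disjoint_left]
    intro x hx hx'
    simp only [f, Finset.mem_sdiff, Finset.mem_filter, Finset.mem_univ, true_and] at hx hx'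
    apply hx.2
    rw [← hZ U ((hs U).mp hU) V ((hs V).mp hV) hne]
    exact ⟨hx.1, hx'.1⟩
  have hcardf : ∀ U ∈ s, (f U).card = Nat.card F ^ k - Nat.card F ^ c := by
    intro U hU
    rw [hs] at hU
    obtain ⟨V, hV, hne⟩ := hex U hU
    rw [Finset.card_sdiff_of_subset, hsz, hsz, hr U hU, hZr]
    intro x hx
    simp only [Finset.mem_filter, Finset.mem_univ, true_and] at hx ⊢
    rw [← hZ U hU V hV hne] at hx
    exact hx.1
  have hb := Finset.card_biUnion hdisj
  rw [Finset.sum_congr rfl hcardf, Finset.sum_const, smul_eq_mul] at hb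
  rw [Set.ncard_eq_toFinset_card _ hfin]
  change s.card * _ ≤ _
  rw [← hb, ← hTr, ← hsz]
  apply Finset.card_le_card
  intro x hx
  simp only [f, Finset.mem_biUnion, Finset.mem_sdiff, Finset.mem_filter, Finset.mem_univ,
    true_and] at hx ⊢
  obtain ⟨U, hU, hxU, -⟩ := hx
  rw [hs] at hU
  obtain ⟨V, hV, hne⟩ := hex U hU
  rw [← hT U hU V hV hne]
  exact Submodule.mem_sup_left hxU

open Classical in
theorem card_mem {F : Type} [Field F] [Fintype F] {n : ℕ} (W : Submodule F (Fin n → F)) :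
    (Finset.univ.filter (· ∈ W)).card = Fintype.card F ^ finrank F W := by
  rw [← Nat.card_eq_fintype_card, ← card_sub, Nat.card_eq_fintype_card, Fintype.card_subtype]

open Classical in
theorem quad_identity {F : Type} [Field F] [Fintype F] {n k c : ℕ}
    (s : Finset (Submodule F (Fin n → F)))
    (h2 : ∀ U ∈ s, finrank F U = k)
    (h3 : ∀ U ∈ s, ∀ V ∈ s, U ≠ V → finrank F ↥(U ⊓ V) = c)
    (a : Submodule F (Fin n → F) → ℤ) (ha : ∑ V ∈ s, a V = 0) :
    ∑ y : Fin n → F, (∑ V ∈ s, if y ∈ V then a V else 0) ^ 2 =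
      ((Fintype.card F : ℤ) ^ k - (Fintype.card F : ℤ) ^ c) * ∑ V ∈ s, a V ^ 2 := by
  have hq : ∀ V ∈ s, ∀ W ∈ s,
      ∑ y : Fin n → F, (if y ∈ V then a V else 0) * (if y ∈ W then a W else 0) =
      a V * a W * (Fintype.card F : ℤ) ^ c +
        if V = W then a V * a W * ((Fintype.card F : ℤ) ^ k - (Fintype.card F : ℤ) ^ c) else 0 := by
    intro V hV W hW
    have e1 : ∀ y : Fin n → F, (if y ∈ V then a V else 0) * (if y ∈ W then a W else 0) =
        if y ∈ V ⊓ W then a V * a W else 0 := by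
      intro y
      by_cases h1 : y ∈ V <;> by_cases h2 : y ∈ W <;> simp [h1, h2]
    rw [Finset.sum_congr rfl (fun y _ => e1 y), ← Finset.sum_filter, Finset.sum_const, card_mem]
    by_cases hVW : V = W
    · subst hVW
      rw [inf_idem, h2 V hV]; simp; ring
    · rw [h3 V hV W hW hVW]; simp [hVW]; ring
  simp_rw [sq, Finset.sum_mul_sum]
  rw [Finset.sum_comm]
  have : ∀ V ∈ s, ∑ y : Fin n → F, ∑ W ∈ s,
      (if y ∈ V then a V else 0) * (if y ∈ W then a W else 0) =
      ((Fintype.card F : ℤ) ^ k - (Fintype.card F : ℤ) ^ c) * (a V * a V) := by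
    intro V hV
    rw [Finset.sum_comm, Finset.sum_congr rfl (fun W hW => hq V hV W hW), Finset.sum_add_distrib,
      ← Finset.sum_mul, ← Finset.mul_sum, ha, Finset.sum_ite_eq]
    simp [hV]; ring
  rw [Finset.sum_congr rfl this, Finset.mul_sum]

open Classical in
theorem light_heavy {F : Type} [Field F] [Fintype F] {n k c : ℕ}
    (s : Finset (Submodule F (Fin n → F)))
    (h2 : ∀ U ∈ s, finrank F U = k)
    (h3 : ∀ U ∈ s, ∀ V ∈ s, U ≠ V → finrank F ↥(U ⊓ V) = c)
    (x : Fin n → F) (hx : x ≠ 0) :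
    ((Fintype.card F : ℤ) - 1) * ((s.filter (x ∈ ·)).card * (s.filter (¬ x ∈ ·)).card) ≤
      (Fintype.card F : ℤ) ^ k * s.card := by
  set d : ℕ := (s.filter (x ∈ ·)).card with hd
  set e : ℕ := (s.filter (¬ x ∈ ·)).card with he
  have hde : d + e = s.card := Finset.card_filter_add_card_filter_not _
  let a : Submodule F (Fin n → F) → ℤ := fun V => if x ∈ V then (e : ℤ) else -(d : ℤ)
  have ha : ∑ V ∈ s, a V = 0 := by
    simp only [a, Finset.sum_ite, Finset.sum_const, ← hd, ← he]
    simp; ring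
  have ha2 : ∑ V ∈ s, a V ^ 2 = (d * e) * s.card := by
    have : ∀ V ∈ s, a V ^ 2 = if x ∈ V then (e : ℤ) ^ 2 else (d : ℤ) ^ 2 := by
      intro V _
      by_cases h : x ∈ V <;> simp [a, h]
    rw [Finset.sum_congr rfl this, Finset.sum_ite, Finset.sum_const, Finset.sum_const, ← hd, ← he,
      ← hde]
    push_cast
    simp; ring
  have hq := quad_identity s h2 h3 a ha
  rw [ha2] at hq
  let T : Finset (Fin n → F) := (Finset.univ.filter (fun t : F => t ≠ 0)).image (fun t => t • x)
  have hT : T.card = Fintype.card F - 1 := by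
    rw [Finset.card_image_of_injective _ (smul_left_injective F hx), Finset.filter_ne',
      Finset.card_erase_of_mem (Finset.mem_univ _), Finset.card_univ]
  have hle : ∑ y ∈ T, ((d : ℤ) * e) ^ 2 ≤
      ∑ y : Fin n → F, (∑ V ∈ s, if y ∈ V then a V else 0) ^ 2 := by
    refine le_trans (le_of_eq ?_) (Finset.sum_le_sum_of_subset_of_nonneg (Finset.subset_univ T)
      (fun y _ _ => sq_nonneg _))
    refine Finset.sum_congr rfl fun y hy => ?_
    simp only [T, Finset.mem_image, Finset.mem_filter, Finset.mem_univ, true_and] at hy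
    obtain ⟨t, ht, rfl⟩ := hy
    congr 1
    have : ∀ V ∈ s, (if t • x ∈ V then a V else 0) = if x ∈ V then (e : ℤ) else 0 := by
      intro V _
      rw [Submodule.smul_mem_iff _ ht]
      by_cases h : x ∈ V <;> simp [a, h]
    rw [Finset.sum_congr rfl this, ← Finset.sum_filter, Finset.sum_const, ← hd]
    simp
  rw [Finset.sum_const, hT, hq] at hle
  have hc1 : 1 ≤ Fintype.card F := Fintype.card_pos
  rw [nsmul_eq_mul, Nat.cast_sub hc1] at hle
  have hp : (0 : ℤ) ≤ (d : ℤ) * e := by positivity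
  have hpc : (0 : ℤ) ≤ (Fintype.card F : ℤ) ^ c := by positivity
  have hpk : (0 : ℤ) ≤ (Fintype.card F : ℤ) ^ k := by positivity
  rcases hp.eq_or_lt with h0 | h0
  · rw [← h0, mul_zero]; positivity
  · have h5 : ((Fintype.card F : ℤ) - 1) * (d * e) * (d * e) ≤
        ((Fintype.card F : ℤ) ^ k * s.card) * (d * e) := by
      have h6 : (0 : ℤ) ≤ (Fintype.card F : ℤ) ^ c * (((d : ℤ) * e) * s.card) := by positivity
      push_cast at hle
      nlinarith
    exact le_of_mul_le_mul_right h5 h0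

open Classical in
theorem double_count {F : Type} [Field F] [Fintype F] {n : ℕ}
    (s : Finset (Submodule F (Fin n → F))) (Y : Submodule F (Fin n → F)) :
    ∑ y ∈ Finset.univ.filter (· ∈ Y), (s.filter (y ∈ ·)).card =
      ∑ V ∈ s, Fintype.card F ^ finrank F ↥(Y ⊓ V) := by
  have := Finset.sum_card_bipartiteAbove_eq_sum_card_bipartiteBelow
    (s := Finset.univ.filter (· ∈ Y)) (t := s) (fun (y : Fin n → F) V => y ∈ V)
  simp only [Finset.bipartiteAbove, Finset.bipartiteBelow] at this
  rw [this]
  refine Finset.sum_congr rfl fun V _ => ?_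
  rw [← card_mem, Finset.filter_filter]
  simp only [Submodule.mem_inf]

open Classical in
theorem deza {F : Type} [Field F] [Fintype F] {n k c : ℕ} (hc : 1 ≤ c) (hck : c < k)
    (hq : 100 ≤ Fintype.card F)
    (s : Finset (Submodule F (Fin n → F)))
    (h2 : ∀ U ∈ s, finrank F U = k)
    (h3 : ∀ U ∈ s, ∀ V ∈ s, U ≠ V → finrank F ↥(U ⊓ V) = c)
    (hm : Fintype.card F ^ (2 * k - 1) ≤ s.card) :
    ∃ Z : Submodule F (Fin n → F), ∀ U ∈ s, ∀ V ∈ s, U ≠ V → U ⊓ V = Z := by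
  set q := Fintype.card F with hqdef
  set m := s.card with hmdef
  obtain ⟨P, hP⟩ : ∃ P, P = q ^ (k - 1) := ⟨_, rfl⟩
  have hP1 : 1 ≤ P := hP ▸ Nat.one_le_pow _ _ (by omega)
  have hqk : q ^ k = q * P := by
    rw [hP, ← pow_succ']; congr 1; omega
  have hq2k : q ^ (2 * k - 1) = q * P * P := by
    rw [← hqk, hP, ← pow_add]; congr 1; omega
  rw [hq2k] at hm
  have hmP : 100 * P ≤ m := by nlinarith [Nat.mul_le_mul hq hP1, Nat.mul_le_mul hq hP1]
  let d : (Fin n → F) → ℕ := fun x => (s.filter (x ∈ ·)).card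
  have hdm : ∀ x, d x ≤ m := fun x => Finset.card_filter_le _ _
  have hlh : ∀ x, d x ≤ 4 * P ∨ m ≤ d x + 4 * P := by
    intro x
    by_cases hx : x = 0
    · right
      have : d x = m := by
        simp [d, hx, hmdef]
      omega
    by_contra! hcon
    obtain ⟨c1, c2⟩ := hcon
    have hl := light_heavy s h2 h3 x hx
    have hde : d x + (s.filter (¬ x ∈ ·)).card = m := Finset.card_filter_add_card_filter_not _
    set e : ℕ := (s.filter (¬ x ∈ ·)).card
    have c3 : 4 * P < e := by omega
    change ((q : ℤ) - 1) * ((d x : ℤ) * e) ≤ (q : ℤ) ^ k * (m : ℤ) at hl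
    have hqk' : (q : ℤ) ^ k = q * P := by exact_mod_cast hqk
    rw [hqk'] at hl
    have hde' : (d x : ℤ) + e = m := by exact_mod_cast hde
    have c1' : (4 * P : ℤ) < d x := by exact_mod_cast c1
    have c3' : (4 * P : ℤ) < e := by exact_mod_cast c3
    have hq' : (100 : ℤ) ≤ q := by exact_mod_cast hq
    have hP' : (1 : ℤ) ≤ P := by exact_mod_cast hP1
    have hA : (2 * P * m : ℤ) < d x * e := by nlinarith
    have hB : (0 : ℤ) < 2 * P * m := by rw [← hde']; nlinarith
    nlinarith
  let Z : Submodule F (Fin n → F) :=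
    { carrier := {x | m ≤ d x + 4 * P}
      add_mem' := by
        intro x y hx hy
        change m ≤ d x + 4 * P at hx
        change m ≤ d y + 4 * P at hy
        change m ≤ d (x + y) + 4 * P
        have h1 : (s.filter (x ∈ ·)) ∩ (s.filter (y ∈ ·)) ⊆ s.filter (x + y ∈ ·) := by
          intro V hV
          simp only [Finset.mem_inter, Finset.mem_filter] at hV ⊢
          exact ⟨hV.1.1, V.add_mem hV.1.2 hV.2.2⟩
        have h2 : ((s.filter (x ∈ ·)) ∩ (s.filter (y ∈ ·))).card ≤ d (x + y) :=
          Finset.card_le_card h1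
        have h3 := Finset.card_union_add_card_inter (s.filter (x ∈ ·)) (s.filter (y ∈ ·))
        have h4 : ((s.filter (x ∈ ·)) ∪ (s.filter (y ∈ ·))).card ≤ m :=
          Finset.card_le_card (Finset.union_subset (Finset.filter_subset _ _)
            (Finset.filter_subset _ _))
        change _ = d x + d y at h3
        have := hlh (x + y)
        omega
      zero_mem' := by
        change m ≤ d 0 + 4 * P
        have : d 0 = m := by simp [d, hmdef]
        omega
      smul_mem' := by
        intro t x hx
        change m ≤ d x + 4 * P at hx
        change m ≤ d (t • x) + 4 * P
        have : d x ≤ d (t • x) := by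
          apply Finset.card_le_card
          intro V hV
          simp only [Finset.mem_filter] at hV ⊢
          exact ⟨hV.1, V.smul_mem t hV.2⟩
        omega }
  have hZ : ∀ x, x ∈ Z ↔ m ≤ d x + 4 * P := fun x => Iff.rfl
  have hqc : 1 ≤ q ^ c := Nat.one_le_pow _ _ (by omega)
  have hheavy : ∀ Y : Submodule F (Fin n → F), Y ≤ Z →
      q ^ finrank F Y * (m - 4 * P) ≤ ∑ V ∈ s, q ^ finrank F ↥(Y ⊓ V) := by
    intro Y hY
    rw [← double_count, ← card_mem, ← smul_eq_mul, ← Finset.sum_const]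
    apply Finset.sum_le_sum
    intro y hy
    simp only [Finset.mem_filter, Finset.mem_univ, true_and] at hy
    have := (hZ y).mp (hY hy)
    change m - 4 * P ≤ d y
    omega
  obtain ⟨r, hr⟩ : ∃ r, m = 4 * P + r := ⟨m - 4 * P, by omega⟩
  have hr2 : m - 4 * P = r := by omega
  rw [hr2] at hheavy
  -- members meet Z in dimension at most c
  have hle : ∀ V ∈ s, finrank F ↥(V ⊓ Z) ≤ c := by
    intro V hV
    by_contra! hlt
    have h := hheavy (V ⊓ Z) inf_le_right
    rw [← Finset.add_sum_erase s _ hV] at h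
    have hb : ∑ W ∈ s.erase V, q ^ finrank F ↥(V ⊓ Z ⊓ W) ≤ (s.erase V).card * q ^ c := by
      rw [← smul_eq_mul]
      apply Finset.sum_le_card_nsmul
      intro W hW
      rw [Finset.mem_erase] at hW
      apply Nat.pow_le_pow_right (by omega)
      rw [← h3 V hV W hW.2 (Ne.symm hW.1)]
      exact Submodule.finrank_mono (inf_le_inf_right _ inf_le_left)
    have hcard : (s.erase V).card ≤ m := Finset.card_erase_le
    have hself : q ^ finrank F ↥(V ⊓ Z ⊓ V) ≤ q ^ finrank F ↥(V ⊓ Z) :=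
      Nat.pow_le_pow_right (by omega) (Submodule.finrank_mono inf_le_left)
    have hge : q * q ^ c ≤ q ^ finrank F ↥(V ⊓ Z) := by
      rw [← pow_succ']; exact Nat.pow_le_pow_right (by omega) hlt
    generalize q ^ finrank F ↥(V ⊓ Z) = A at *
    generalize q ^ c = B at *
    have h5 : A * r ≤ A + m * B := by
      calc A * r ≤ _ := h
        _ ≤ A + m * B := add_le_add hself (hb.trans (Nat.mul_le_mul_right _ hcard))
    have h6 : 100 * B ≤ A := (Nat.mul_le_mul_right _ hq).trans hge
    obtain ⟨r', rfl⟩ : ∃ r', r = r' + 1 := ⟨r - 1, by omega⟩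
    have h7 : A * r' ≤ m * B := by nlinarith
    have h8 : 100 * B * r' ≤ m * B := (Nat.mul_le_mul_right _ h6).trans h7
    have h9 : 100 * r' ≤ m := by
      have : (100 * r') * B ≤ m * B := by linarith
      exact Nat.le_of_mul_le_mul_right this (by omega)
    omega
  have hZle : finrank F Z ≤ c := by
    by_contra! hlt
    have h := hheavy Z le_rfl
    have hb : ∑ W ∈ s, q ^ finrank F ↥(Z ⊓ W) ≤ s.card * q ^ c := by
      rw [← smul_eq_mul]
      apply Finset.sum_le_card_nsmul
      intro W hW
      apply Nat.pow_le_pow_right (by omega)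
      rw [inf_comm]
      exact hle W hW
    have hge : q * q ^ c ≤ q ^ finrank F Z := by
      rw [← pow_succ']; exact Nat.pow_le_pow_right (by omega) hlt
    generalize q ^ finrank F Z = A at *
    generalize q ^ c = B at *
    have h6 : 100 * B ≤ A := (Nat.mul_le_mul_right _ hq).trans hge
    have h8 : 100 * B * r ≤ m * B := (Nat.mul_le_mul_right _ h6).trans (h.trans hb)
    have h9 : 100 * r ≤ m := by
      have : (100 * r) * B ≤ m * B := by linarith
      exact Nat.le_of_mul_le_mul_right this (by omega)
    omega
  have hge : ∀ V ∈ s, c ≤ finrank F ↥(V ⊓ Z) := by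
    intro V hV
    by_contra! hlt
    have h := double_count s V
    have hlow : m * q ^ c ≤ ∑ W ∈ s, q ^ finrank F ↥(V ⊓ W) := by
      rw [← smul_eq_mul]
      apply Finset.card_nsmul_le_sum
      intro W hW
      apply Nat.pow_le_pow_right (by omega)
      by_cases hVW : V = W
      · subst hVW; rw [inf_idem, h2 V hV]; omega
      · rw [h3 V hV W hW hVW]
    have hup : ∑ y ∈ Finset.univ.filter (· ∈ V), (s.filter (y ∈ ·)).card ≤
        q ^ finrank F ↥(V ⊓ Z) * m + q ^ k * (4 * P) := by
      have : ∀ y ∈ Finset.univ.filter (· ∈ V), (s.filter (y ∈ ·)).card ≤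
          (if y ∈ Z then m else 0) + 4 * P := by
        intro y _
        by_cases hy : y ∈ Z
        · simp only [hy, if_true]
          exact (hdm y).trans (Nat.le_add_right _ _)
        · simp only [hy, if_false, zero_add]
          have h1 := (hlh y).resolve_right (fun h => hy ((hZ y).mpr h))
          exact h1
      refine (Finset.sum_le_sum this).trans (le_of_eq ?_)
      rw [Finset.sum_add_distrib, ← Finset.sum_filter, Finset.sum_const, Finset.sum_const,
        Finset.filter_filter, card_mem, h2 V hV, ← card_mem]
      simp only [Submodule.mem_inf, smul_eq_mul, hqdef]
    rw [h] at hup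
    have hh := hlow.trans hup
    have hpow : q * q ^ finrank F ↥(V ⊓ Z) ≤ q ^ c := by
      rw [← pow_succ']; exact Nat.pow_le_pow_right (by omega) hlt
    have hqc' : q ≤ q ^ c := Nat.le_self_pow (by omega) _
    rw [hqk] at hh
    generalize q ^ finrank F ↥(V ⊓ Z) = A at *
    generalize q ^ c = B at *
    -- m B ≤ A m + 4 q P P, q A ≤ B, q ≤ B, q P P ≤ m
    have g1 : m * B ≤ A * m + 4 * m := by nlinarith
    have g2 : 0 < m := by omega
    have g3 : B ≤ A + 4 := by
      have : m * B ≤ m * (A + 4) := by linarith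
      exact Nat.le_of_mul_le_mul_left this g2
    have g4 : 100 * A ≤ B := (Nat.mul_le_mul_right _ hq).trans hpow
    omega
  have hsub : ∀ V ∈ s, Z ≤ V := by
    intro V hV
    have : V ⊓ Z = Z := Submodule.eq_of_le_of_finrank_le inf_le_right (hZle.trans (hge V hV))
    rw [← this]; exact inf_le_left
  refine ⟨Z, fun U hU V hV hUV => ?_⟩
  refine (Submodule.eq_of_le_of_finrank_le (le_inf (hsub U hU) (hsub V hV)) ?_).symm
  rw [h3 U hU V hV hUV]
  exact (hge U hU).trans (Submodule.finrank_mono inf_le_right)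

theorem deza_set {F : Type} [Field F] [Fintype F] {n k c : ℕ} (hck : c < k)
    (hq : 100 ≤ Fintype.card F) {C : Set (Submodule F (Fin n → F))}
    (hC : IsEquidistantCode F n k c C)
    (hm : Fintype.card F ^ (2 * k - 1) ≤ C.ncard) : IsSunflower C := by
  have := finite_sub F n
  have hfin : C.Finite := Set.toFinite _
  obtain ⟨h1, h2, h3⟩ := hC
  by_cases hc : c = 0
  · refine ⟨⊥, fun U hU V hV hne => ?_⟩
    rw [← Submodule.finrank_eq_zero (R := F), h3 U hU V hV hne, hc]
  · rw [Set.ncard_eq_toFinset_card _ hfin] at hm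
    obtain ⟨Z, hZ⟩ := deza (by omega) hck hq hfin.toFinset (by simpa using h2)
      (fun U hU V hV => h3 U (by simpa using hU) V (by simpa using hV)) hm
    exact ⟨Z, fun U hU V hV => hZ U (by simpa using hU) V (by simpa using hV)⟩

/-- Classification of optimal equidistant codes: for `q ≫ 0`, if
`c ∈ {0, k-1, 2k-n}`, or `n ≤ (3k+1)/2`, or `n ≥ 3k+1`, then every optimal
equidistant `c`-intersecting code `C ⊆ G_q(k,n)` is a sunflower or the orthogonal
of a sunflower; moreover, unless `c = 0` and `n = 2k`, exactly one of the two
alternatives holds. -/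
theorem classification_of_optimal_equidistant_codes
    (k n c : ℕ) (hk : 1 ≤ k) (hkn : k < n) (hc1 : 2 * k ≤ n + c) (hc2 : c ≤ k - 1) :
    ∃ Q : ℕ, ∀ q : ℕ, IsPrimePow q → Q ≤ q →
      ∀ (F : Type) [Field F] [Fintype F], Fintype.card F = q →
        ∀ C : Set (Submodule F (Fin n → F)),
          IsEquidistantCode F n k c C → C.ncard = eMax F n k c →
          (c = 0 ∨ c = k - 1 ∨ (c : ℤ) = 2 * k - n ∨ 2 * n ≤ 3 * k + 1 ∨ 3 * k + 1 ≤ n) →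
          (IsSunflower C ∨ IsSunflower (stdOrth '' C)) ∧
          (¬ (c = 0 ∧ n = 2 * k) → Xor' (IsSunflower C) (IsSunflower (stdOrth '' C))) := by
  refine ⟨100, ?_⟩
  intro q _ hq F _ _ hF C hC hCmax hcase
  have hck : c < k := by omega
  have hF' : Nat.card F = q := by rw [Nat.card_eq_fintype_card, hF]
  have hge1 : q ^ (n - k) ≤ C.ncard := by
    rw [hCmax, ← hF']; exact eMax_ge hkn hck hc1
  have hge2 : q ^ k ≤ C.ncard := by
    rw [hCmax, ← hF']; exact eMax_ge' hkn hck hc1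
  have hCd := code_dual hkn hck hC
  have hzero : ∀ (k' : ℕ) (C' : Set (Submodule F (Fin n → F))),
      IsEquidistantCode F n k' 0 C' → IsSunflower C' := by
    intro k' C' h
    refine ⟨⊥, fun U hU V hV hne => ?_⟩
    rw [← Submodule.finrank_eq_zero (R := F), h.2.2 U hU V hV hne]
  have hor : IsSunflower C ∨ IsSunflower (stdOrth '' C) := by
    rcases hcase with h | h | h | h | h
    · subst h
      exact Or.inl (hzero _ _ hC)
    · exact code_pred (by omega) hC
    · right
      rw [show n + c - 2 * k = 0 by omega] at hCd
      exact hzero _ _ hCd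
    · right
      refine deza_set (by omega) (by omega) hCd ?_
      rw [ncard_stdOrth, hF]
      exact (Nat.pow_le_pow_right (by omega) (by omega)).trans hge2
    · left
      refine deza_set hck (by omega) hC ?_
      rw [hF]
      exact (Nat.pow_le_pow_right (by omega) (by omega)).trans hge1
  refine ⟨hor, fun hne => ?_⟩
  have hnot : ¬ (IsSunflower C ∧ IsSunflower (stdOrth '' C)) := by
    rintro ⟨s1, s2⟩
    have hb := both_bound hck hC s1 s2
    rw [hF'] at hb
    have hbig : q ^ (k - c + 1) ≤ C.ncard := by
      by_cases hc : c = 0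
      · exact (Nat.pow_le_pow_right (by omega) (by omega)).trans hge1
      · exact (Nat.pow_le_pow_right (by omega) (by omega)).trans hge2
    have e1 : q ^ k = q ^ (k - c) * q ^ c := by rw [← pow_add]; congr 1; omega
    have e2 : q ^ (2 * k - c) = q ^ (k - c) * q ^ k := by rw [← pow_add]; congr 1; omega
    have e3 : q ≤ q ^ (k - c) := Nat.le_self_pow (by omega) _
    have e4 : 2 * q ^ c ≤ q ^ k := by
      rw [e1]; exact Nat.mul_le_mul_right _ (by omega)
    have e5 : q ^ k ≤ 2 * (q ^ k - q ^ c) := by omega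
    have e6 : 0 < q ^ k := Nat.pow_pos (by omega)
    rw [e2] at hb
    rw [pow_succ] at hbig
    generalize q ^ k - q ^ c = D at *
    have g1 : C.ncard * q ^ k ≤ 2 * (q ^ (k - c) * q ^ k) := by nlinarith
    have g2 : C.ncard ≤ 2 * q ^ (k - c) := by
      apply Nat.le_of_mul_le_mul_right _ e6
      linarith
    nlinarith
  rcases hor with h | h
  · exact Or.inl ⟨h, fun h' => hnot ⟨h, h'⟩⟩
  · exact Or.inr ⟨h, fun h' => hnot ⟨h', h⟩⟩
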